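/- arXiv:1305.6582 — 2 statements merged into one kernel-verified Lean document; each statement's English description precedes it below -/
import Mathlib

section
/- For every d₀ ∈ ℂ∖{0}, the assignment k(x_1) = q²x_1, k(x_2) = q⁻¹x_2, k(x_3) = q⁻¹x_3, e(x_1) = −qd₀⁻¹x_1², e(x_2) = d₀⁻¹x_1x_2, e(x_3) = d₀⁻¹x_1x_3, f(x_1) = d₀·1, f(x_2) = 0, f(x_3) = 0, extended by the module-algebra conditions, defines a module-algebra structure of U_q(sl(2)) on the quantum 3-space A_q(3). -/
noncomputable section

open scoped BigOperators

/-- The defining relations of the quantum `n`-space `A_q(n)`: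
`x_i x_j = q • (x_j x_i)` for `i > j`. -/
inductive QRel (q : ℂ) (n : ℕ) : FreeAlgebra ℂ (Fin n) → FreeAlgebra ℂ (Fin n) → Prop
  | rel (i j : Fin n) (h : j < i) :
      QRel q n (FreeAlgebra.ι ℂ i * FreeAlgebra.ι ℂ j)
        (q • (FreeAlgebra.ι ℂ j * FreeAlgebra.ι ℂ i))

/-- The quantum `n`-space `A_q(n)`. -/
abbrev QSpace (q : ℂ) (n : ℕ) : Type := RingQuot (QRel q n)

/-- The generator `x_i` of the quantum `n`-space. -/
def Xg (q : ℂ) (n : ℕ) (i : Fin n) : QSpace q n :=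
  RingQuot.mkAlgHom ℂ (QRel q n) (FreeAlgebra.ι ℂ i)

/-- The Cartan matrix of `sl(m+1)`: `a_{ii} = 2`, `a_{ij} = -1` if `|i-j| = 1`,
`a_{ij} = 0` if `|i-j| > 1`. -/
def cartan (m : ℕ) (i j : Fin m) : ℤ :=
  if i = j then 2 else if ((i : ℤ) - (j : ℤ)).natAbs = 1 then -1 else 0

/-- A module-algebra structure of `U_q(sl(m+1))` on a unital `ℂ`-algebra `A`:
`ℂ`-linear maps `k_i` (unital algebra automorphisms with two-sided inverses `(k i).symm`),
`e_i`, `f_i` for `1 ≤ i ≤ m`, satisfying the twisted Leibniz rules and the defining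
operator relations of `U_q(sl(m+1))`. -/
structure UqslMA (q : ℂ) (m : ℕ) (A : Type) [Ring A] [Algebra ℂ A] where
  k : Fin m → (A ≃ₐ[ℂ] A)
  e : Fin m → (A →ₗ[ℂ] A)
  f : Fin m → (A →ₗ[ℂ] A)
  e_mul : ∀ (i : Fin m) (a b : A), e i (a * b) = a * e i b + e i a * k i b
  f_mul : ∀ (i : Fin m) (a b : A), f i (a * b) = (k i).symm a * f i b + f i a * b
  e_one : ∀ i : Fin m, e i 1 = 0
  f_one : ∀ i : Fin m, f i 1 = 0
  k_comm : ∀ (i j : Fin m) (a : A), k i (k j a) = k j (k i a)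
  ke : ∀ (i j : Fin m) (a : A), k i (e j ((k i).symm a)) = q ^ cartan m i j • e j a
  kf : ∀ (i j : Fin m) (a : A), k i (f j ((k i).symm a)) = q ^ (-cartan m i j) • f j a
  ef : ∀ (i j : Fin m) (a : A),
      e i (f j a) - f j (e i a) =
        if i = j then (q - q⁻¹)⁻¹ • (k i a - (k i).symm a) else 0
  ee_comm : ∀ i j : Fin m, cartan m i j = 0 → ∀ a : A, e i (e j a) = e j (e i a)
  ff_comm : ∀ i j : Fin m, cartan m i j = 0 → ∀ a : A, f i (f j a) = f j (f i a)
  serre_e : ∀ i j : Fin m, cartan m i j = -1 → ∀ a : A,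
      e i (e i (e j a)) - (q + q⁻¹) • e i (e j (e i a)) + e j (e i (e i a)) = 0
  serre_f : ∀ i j : Fin m, cartan m i j = -1 → ∀ a : A,
      f i (f i (f j a)) - (q + q⁻¹) • f i (f j (f i a)) + f j (f i (f i a)) = 0

/-- Isomorphism of module-algebra structures: an algebra automorphism `ψ` of `A` with
`ψ ∘ π₁(h) ∘ ψ⁻¹ = π₂(h)` for every generator `h ∈ {k_i^{±1}, e_i, f_i}`. -/
def UqslMA.Iso {q : ℂ} {m : ℕ} {A : Type} [Ring A] [Algebra ℂ A]
    (π₁ π₂ : UqslMA q m A) : Prop :=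
  ∃ ψ : A ≃ₐ[ℂ] A,
    (∀ (i : Fin m) (a : A), ψ (π₁.k i (ψ.symm a)) = π₂.k i a) ∧
    (∀ (i : Fin m) (a : A), ψ ((π₁.k i).symm (ψ.symm a)) = (π₂.k i).symm a) ∧
    (∀ (i : Fin m) (a : A), ψ (π₁.e i (ψ.symm a)) = π₂.e i a) ∧
    (∀ (i : Fin m) (a : A), ψ (π₁.f i (ψ.symm a)) = π₂.f i a)

/-- The generator `x_1` of the quantum 3-space. -/
def Z1 (q : ℂ) : QSpace q 3 := Xg q 3 0
/-- The generator `x_2` of the quantum 3-space. -/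
def Z2 (q : ℂ) : QSpace q 3 := Xg q 3 1
/-- The generator `x_3` of the quantum 3-space. -/
def Z3 (q : ℂ) : QSpace q 3 := Xg q 3 2

namespace QSpace

variable {q : ℂ} {n : ℕ}

theorem Xg_mul_Xg {i j : Fin n} (h : j < i) :
    Xg q n i * Xg q n j = q • (Xg q n j * Xg q n i) := by
  simpa [Xg] using RingQuot.mkAlgHom_rel ℂ (QRel.rel (q := q) i j h)

/-- The universal property of the quantum space. -/
def lift {B : Type*} [Ring B] [Algebra ℂ B] (g : Fin n → B)
    (hg : ∀ i j, j < i → g i * g j = q • (g j * g i)) : QSpace q n →ₐ[ℂ] B :=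
  RingQuot.liftAlgHom ℂ ⟨FreeAlgebra.lift ℂ g, by
    rintro _ _ ⟨i, j, h⟩
    simpa using hg i j h⟩

@[simp]
theorem lift_Xg {B : Type*} [Ring B] [Algebra ℂ B] (g : Fin n → B)
    (hg : ∀ i j, j < i → g i * g j = q • (g j * g i)) (i : Fin n) :
    lift g hg (Xg q n i) = g i := by
  simp [lift, Xg]

theorem induction {P : QSpace q n → Prop} (scalar : ∀ c : ℂ, P (algebraMap ℂ _ c))
    (gen : ∀ i, P (Xg q n i)) (mul : ∀ a b, P a → P b → P (a * b))
    (add : ∀ a b, P a → P b → P (a + b)) (a : QSpace q n) : P a := by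
  obtain ⟨x, rfl⟩ := RingQuot.mkAlgHom_surjective ℂ (QRel q n) a
  induction x using FreeAlgebra.induction with
  | grade0 r => simpa using scalar r
  | grade1 i => exact gen i
  | mul a b ha hb => simpa using mul _ _ ha hb
  | add a b ha hb => simpa using add _ _ ha hb

/-- The endomorphism rescaling each generator. -/
def scale (c : Fin n → ℂ) : QSpace q n →ₐ[ℂ] QSpace q n :=
  lift (fun i => c i • Xg q n i) fun i j h => by
    simp only [smul_mul_smul_comm, Xg_mul_Xg h]
    rw [smul_comm, mul_comm]

@[simp]
theorem scale_Xg (c : Fin n → ℂ) (i : Fin n) : scale c (Xg q n i) = c i • Xg q n i :=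
  lift_Xg _ _ _

theorem scale_comp_scale {c d : Fin n → ℂ} (h : ∀ i, c i * d i = 1) :
    (scale c).comp (scale d) = AlgHom.id ℂ (QSpace q n) := by
  refine AlgHom.ext fun a => ?_
  induction a using induction with
  | scalar r => simp
  | gen i => simp [smul_smul, mul_comm, h]
  | mul a b ha hb => rw [map_mul, ha, hb, map_mul]
  | add a b ha hb => rw [map_add, ha, hb, map_add]

/-- The automorphism rescaling each generator by a nonzero scalar. -/
def scaleEquiv (c : Fin n → ℂ) (hc : ∀ i, c i ≠ 0) : QSpace q n ≃ₐ[ℂ] QSpace q n :=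
  AlgEquiv.ofAlgHom (scale c) (scale fun i => (c i)⁻¹)
    (scale_comp_scale fun i => mul_inv_cancel₀ (hc i))
    (scale_comp_scale fun i => inv_mul_cancel₀ (hc i))

@[simp]
theorem scaleEquiv_Xg (c : Fin n → ℂ) (hc : ∀ i, c i ≠ 0) (i : Fin n) :
    scaleEquiv c hc (Xg q n i) = c i • Xg q n i :=
  scale_Xg _ _

@[simp]
theorem scaleEquiv_symm_Xg (c : Fin n → ℂ) (hc : ∀ i, c i ≠ 0) (i : Fin n) :
    (scaleEquiv c hc).symm (Xg q n i) = (c i)⁻¹ • Xg q n i :=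
  scale_Xg _ _

/-- A `(σ, τ)`-twisted derivation can be prescribed on the generators, as soon as its values
there are compatible with the defining relations. -/
theorem exists_twisted_derivation (σ τ : QSpace q n →ₐ[ℂ] QSpace q n) (v : Fin n → QSpace q n)
    (hv : ∀ i j, j < i → σ (Xg q n i) * v j + v i * τ (Xg q n j) =
      q • (σ (Xg q n j) * v i + v j * τ (Xg q n i))) :
    ∃ D : QSpace q n →ₗ[ℂ] QSpace q n,
      (∀ a b, D (a * b) = σ a * D b + D a * τ b) ∧ D 1 = 0 ∧ ∀ i, D (Xg q n i) = v i := by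
  let Φ : QSpace q n →ₐ[ℂ] Matrix (Fin 2) (Fin 2) (QSpace q n) :=
    lift (fun i => !![σ (Xg q n i), v i; 0, τ (Xg q n i)]) fun i j h => by
      have hσ := congrArg σ (Xg_mul_Xg (q := q) h)
      have hτ := congrArg τ (Xg_mul_Xg (q := q) h)
      simp only [map_mul, map_smul] at hσ hτ
      simp [Matrix.smul_of, hσ, hτ, hv i j h]
  have hΦ (a : QSpace q n) : Φ a 0 0 = σ a ∧ Φ a 1 0 = 0 ∧ Φ a 1 1 = τ a := by
    induction a using induction with
    | scalar r => simp [Matrix.algebraMap_matrix_apply]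
    | gen i => simp [Φ]
    | mul a b ha hb => simp [Matrix.mul_apply, ha, hb]
    | add a b ha hb => simp [ha, hb]
  refine ⟨{ toFun := fun a => Φ a 0 1, map_add' := by simp, map_smul' := by simp },
    fun a b => ?_, ?_, fun i => ?_⟩
  · simp [Matrix.mul_apply, hΦ]
  · simp
  · simp [Φ]

end QSpace

/-- The simplest `U_q(sl(2))`-module-algebra structure on `A_q(3)` of case `(∗₁₁)`. -/
theorem Uqsl2_on_Aq3_case11_exists (q : ℂ) (hq : q ≠ 0)
    (hq' : ∀ N : ℕ, 0 < N → q ^ N ≠ 1)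
    (d₀ : ℂ) (hd₀ : d₀ ≠ 0) :
    ∃ π : UqslMA q 1 (QSpace q 3),
      π.k 0 (Z1 q) = (q ^ (2 : ℕ)) • Z1 q ∧ π.k 0 (Z2 q) = q⁻¹ • Z2 q ∧
      π.k 0 (Z3 q) = q⁻¹ • Z3 q ∧
      π.e 0 (Z1 q) = (-q * d₀⁻¹) • (Z1 q ^ 2) ∧
      π.e 0 (Z2 q) = d₀⁻¹ • (Z1 q * Z2 q) ∧
      π.e 0 (Z3 q) = d₀⁻¹ • (Z1 q * Z3 q) ∧
      π.f 0 (Z1 q) = d₀ • 1 ∧ π.f 0 (Z2 q) = 0 ∧ π.f 0 (Z3 q) = 0 := by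
  let c : Fin 3 → ℂ := ![q ^ 2, q⁻¹, q⁻¹]
  have hc : ∀ i, c i ≠ 0 := by simp [Fin.forall_fin_succ, c, hq]
  let K : QSpace q 3 ≃ₐ[ℂ] QSpace q 3 := QSpace.scaleEquiv c hc
  have h10 : Z2 q * Z1 q = q • (Z1 q * Z2 q) := QSpace.Xg_mul_Xg (by decide)
  have h20 : Z3 q * Z1 q = q • (Z1 q * Z3 q) := QSpace.Xg_mul_Xg (by decide)
  have h21 : Z3 q * Z2 q = q • (Z2 q * Z3 q) := QSpace.Xg_mul_Xg (by decide)
  have h10' (a) : Z2 q * (Z1 q * a) = q • (Z1 q * (Z2 q * a)) := by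
    rw [← mul_assoc, h10, smul_mul_assoc, mul_assoc]
  have h20' (a) : Z3 q * (Z1 q * a) = q • (Z1 q * (Z3 q * a)) := by
    rw [← mul_assoc, h20, smul_mul_assoc, mul_assoc]
  have K1 : K (Z1 q) = q ^ 2 • Z1 q := QSpace.scaleEquiv_Xg c hc 0
  have K2 : K (Z2 q) = q⁻¹ • Z2 q := QSpace.scaleEquiv_Xg c hc 1
  have K3 : K (Z3 q) = q⁻¹ • Z3 q := QSpace.scaleEquiv_Xg c hc 2
  have L1 : K.symm (Z1 q) = (q ^ 2)⁻¹ • Z1 q := QSpace.scaleEquiv_symm_Xg c hc 0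
  have L2 : K.symm (Z2 q) = q • Z2 q :=
    (QSpace.scaleEquiv_symm_Xg c hc 1).trans (by simp [c, Z2])
  have L3 : K.symm (Z3 q) = q • Z3 q :=
    (QSpace.scaleEquiv_symm_Xg c hc 2).trans (by simp [c, Z3])
  obtain ⟨E, E_mul, E_one, hE⟩ := QSpace.exists_twisted_derivation (AlgHom.id ℂ _) K.toAlgHom
    ![(-q * d₀⁻¹) • Z1 q ^ 2, d₀⁻¹ • (Z1 q * Z2 q), d₀⁻¹ • (Z1 q * Z3 q)] (by
      simp only [Fin.forall_fin_succ]
      simp [← Z1.eq_1, ← Z2.eq_1, ← Z3.eq_1]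
      simp only [K1, K2, K3, pow_two, mul_assoc, mul_smul_comm, smul_smul, h10,
        h20, h21, h10', h20']
      refine ⟨?_, ?_, ?_⟩ <;> match_scalars <;> field_simp <;> ring)
  obtain ⟨F, F_mul, F_one, hF⟩ := QSpace.exists_twisted_derivation K.symm.toAlgHom
    (AlgHom.id ℂ _) ![d₀ • 1, 0, 0] (by
      simp only [Fin.forall_fin_succ]
      simp [← Z1.eq_1, ← Z2.eq_1, ← Z3.eq_1, L2, L3, smul_comm d₀ q])
  replace E_mul : ∀ a b, E (a * b) = a * E b + E a * K b := E_mul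
  replace F_mul : ∀ a b, F (a * b) = K.symm a * F b + F a * b := F_mul
  have E1 : E (Z1 q) = (-q * d₀⁻¹) • Z1 q ^ 2 := hE 0
  have E2 : E (Z2 q) = d₀⁻¹ • (Z1 q * Z2 q) := hE 1
  have E3 : E (Z3 q) = d₀⁻¹ • (Z1 q * Z3 q) := hE 2
  have F1 : F (Z1 q) = d₀ • 1 := hF 0
  have F2 : F (Z2 q) = 0 := hF 1
  have F3 : F (Z3 q) = 0 := hF 2
  have hqq : q ^ 2 - 1 ≠ 0 := sub_ne_zero.mpr (hq' 2 two_pos)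
  have KE (a) : K (E a) = q ^ 2 • E (K a) := by
    induction a using QSpace.induction with
    | scalar r => simp [Algebra.algebraMap_eq_smul_one, E_one]
    | gen i =>
      revert i
      simp only [Fin.forall_fin_succ, IsEmpty.forall_iff, and_true]
      change K (E (Z1 q)) = _ • E (K (Z1 q)) ∧ K (E (Z2 q)) = _ • E (K (Z2 q)) ∧
        K (E (Z3 q)) = _ • E (K (Z3 q))
      simp only [E1, E2, E3, K1, K2, K3, map_smul, map_mul, pow_two, smul_mul_assoc,
        mul_smul_comm, smul_smul]
      refine ⟨?_, ?_, ?_⟩ <;> match_scalars <;> field_simp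
    | mul a b ha hb => simp [E_mul, ha, hb]
    | add a b ha hb => simp [ha, hb]
  have KF (a) : K (F a) = (q ^ 2)⁻¹ • F (K a) := by
    induction a using QSpace.induction with
    | scalar r => simp [Algebra.algebraMap_eq_smul_one, F_one]
    | gen i =>
      revert i
      simp only [Fin.forall_fin_succ, IsEmpty.forall_iff, and_true]
      change K (F (Z1 q)) = _ • F (K (Z1 q)) ∧ K (F (Z2 q)) = _ • F (K (Z2 q)) ∧
        K (F (Z3 q)) = _ • F (K (Z3 q))
      simp [F1, F2, F3, K1, K2, K3, hq]
    | mul a b ha hb => simp [F_mul, ha, hb]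
    | add a b ha hb => simp [ha, hb]
  have KE' (a) : K.symm (E a) = (q ^ 2)⁻¹ • E (K.symm a) := by
    rw [AlgEquiv.symm_apply_eq, map_smul, KE, AlgEquiv.apply_symm_apply,
      inv_smul_smul₀ (pow_ne_zero 2 hq)]
  have EF (a) : E (F a) - F (E a) = (q - q⁻¹)⁻¹ • (K a - K.symm a) := by
    induction a using QSpace.induction with
    | scalar r => simp [Algebra.algebraMap_eq_smul_one, F_one, E_one]
    | gen i =>
      revert i
      simp only [Fin.forall_fin_succ, IsEmpty.forall_iff, and_true]
      change E (F (Z1 q)) - F (E (Z1 q)) = _ • (K (Z1 q) - K.symm (Z1 q)) ∧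
        E (F (Z2 q)) - F (E (Z2 q)) = _ • (K (Z2 q) - K.symm (Z2 q)) ∧
        E (F (Z3 q)) - F (E (Z3 q)) = _ • (K (Z3 q) - K.symm (Z3 q))
      simp only [E1, E2, E3, F1, F2, F3, K1, K2, K3, L1, L2, L3, E_one, F_mul, map_smul, map_zero,
        pow_two, smul_mul_assoc, mul_smul_comm, smul_smul, mul_one, one_mul, mul_zero, zero_add,
        smul_zero]
      refine ⟨?_, ?_, ?_⟩ <;> match_scalars <;> field_simp <;> ring
    | mul a b ha hb =>
      have key : E (F (a * b)) - F (E (a * b)) =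
          K.symm a * (E (F b) - F (E b)) + (E (F a) - F (E a)) * K b := by
        simp only [E_mul, F_mul, map_add, KE', KF, mul_smul_comm, smul_mul_assoc, mul_sub, sub_mul]
        abel
      rw [key, ha, hb, map_mul, map_mul, mul_smul_comm, smul_mul_assoc, ← smul_add, mul_sub,
        sub_mul, sub_add_sub_cancel']
    | add a b ha hb =>
      simp only [map_add]
      rw [add_sub_add_comm, ha, hb, ← smul_add, add_sub_add_comm]
  exact ⟨{ k := fun _ => K
           e := fun _ => E
           f := fun _ => F
           e_mul := fun _ => E_mul
           f_mul := fun _ => F_mul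
           e_one := fun _ => E_one
           f_one := fun _ => F_one
           k_comm := fun _ _ _ => rfl
           ke := fun i j a => by simp [KE, cartan, Subsingleton.elim i j]
           kf := fun i j a => by simp [KF, cartan, Subsingleton.elim i j]
           ef := fun i j a => by simp [EF, Subsingleton.elim i j]
           ee_comm := fun _ _ _ _ => rfl
           ff_comm := fun _ _ _ _ => rfl
           serre_e := fun i j h => by simp [cartan, Subsingleton.elim i j] at h
           serre_f := fun i j h => by simp [cartan, Subsingleton.elim i j] at h },
    K1, K2, K3, E1, E2, E3, F1, F2, F3⟩
end
end

section
/- Let (k_1, k_1^{-1}, e_1, f_1, k_2, k_2^{-1}, e_2, f_2) be a module-algebra structure of U_q(sl(3)) on the quantum 3-space A_q(3) with k_1(x_1) = q⁻²x_1, k_1(x_2) = q⁻¹x_2, k_1(x_3) = q⁻¹x_3, k_2(x_1) = qx_1, k_2(x_2) = q⁻¹x_2, k_2(x_3) = x_3. Then there exist a₀, a₂ ∈ ℂ∖{0} such that e_1(x_1) = a₀·1, e_1(x_2) = e_1(x_3) = 0, e_2(x_1) = 0, e_2(x_2) = a₂x_1, e_2(x_3) = 0, f_1(x_1) = −qa₀⁻¹x_1²,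 f_1(x_2) = −qa₀⁻¹x_1x_2, f_1(x_3) = −qa₀⁻¹x_1x_3, f_2(x_1) = a₂⁻¹x_2, f_2(x_2) = f_2(x_3) = 0. Conversely, each such assignment defines a module-algebra structure of U_q(sl(3)) on A_q(3), and every such structure is isomorphic to the one with a₀ = a₂ = 1. -/
noncomputable section

open scoped BigOperators

/-- The `k`-action of case `(A2)|(B4)`. -/
def KCond13 (q : ℂ) (π : UqslMA q 2 (QSpace q 3)) : Prop :=
  π.k 0 (Z1 q) = (q ^ (-2 : ℤ)) • Z1 q ∧ π.k 0 (Z2 q) = q⁻¹ • Z2 q ∧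
  π.k 0 (Z3 q) = q⁻¹ • Z3 q ∧
  π.k 1 (Z1 q) = q • Z1 q ∧ π.k 1 (Z2 q) = q⁻¹ • Z2 q ∧ π.k 1 (Z3 q) = Z3 q

/-- The `e`/`f`-action of case `(A2)|(B4)` with parameters `a₀`, `a₂`. -/
def EFDesc13 (q : ℂ) (π : UqslMA q 2 (QSpace q 3)) (a₀ a₂ : ℂ) : Prop :=
  π.e 0 (Z1 q) = a₀ • 1 ∧ π.e 0 (Z2 q) = 0 ∧ π.e 0 (Z3 q) = 0 ∧
  π.e 1 (Z1 q) = 0 ∧ π.e 1 (Z2 q) = a₂ • Z1 q ∧ π.e 1 (Z3 q) = 0 ∧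
  π.f 0 (Z1 q) = (-q * a₀⁻¹) • (Z1 q ^ 2) ∧
  π.f 0 (Z2 q) = (-q * a₀⁻¹) • (Z1 q * Z2 q) ∧
  π.f 0 (Z3 q) = (-q * a₀⁻¹) • (Z1 q * Z3 q) ∧
  π.f 1 (Z1 q) = a₂⁻¹ • Z2 q ∧ π.f 1 (Z2 q) = 0 ∧ π.f 1 (Z3 q) = 0

section QuantumSpace

variable {q : ℂ} {n : ℕ}

theorem Xg_mul (i j : Fin n) (h : j < i) :
    Xg q n i * Xg q n j = q • (Xg q n j * Xg q n i) := by
  simpa only [Xg, map_mul, map_smul] using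
    RingQuot.mkAlgHom_rel ℂ (QRel.rel (q := q) i j h)

/-- A subalgebra containing all the generators is everything. -/
theorem QSpace.mem_of_Xg_mem (S : Subalgebra ℂ (QSpace q n)) (h : ∀ i, Xg q n i ∈ S)
    (a : QSpace q n) : a ∈ S := by
  obtain ⟨b, rfl⟩ := RingQuot.mkAlgHom_surjective ℂ (QRel q n) a
  induction b using FreeAlgebra.induction with
  | grade0 r => simpa only [AlgHom.commutes] using S.algebraMap_mem r
  | grade1 i => exact h i
  | mul a b ha hb => simpa only [map_mul] using S.mul_mem ha hb
  | add a b ha hb => simpa only [map_add] using S.add_mem ha hb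

theorem QSpace.algHom_eq {B : Type*} [Ring B] [Algebra ℂ B] {φ ψ : QSpace q n →ₐ[ℂ] B}
    (h : ∀ i, φ (Xg q n i) = ψ (Xg q n i)) : φ = ψ :=
  AlgHom.ext fun a => QSpace.mem_of_Xg_mem (AlgHom.equalizer φ ψ) h a

/-- The universal property of the quantum space. -/
theorem QSpace.exists_algHom {B : Type*} [Ring B] [Algebra ℂ B] (y : Fin n → B)
    (h : ∀ i j, j < i → y i * y j = q • (y j * y i)) :
    ∃ φ : QSpace q n →ₐ[ℂ] B, ∀ i, φ (Xg q n i) = y i := by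
  refine ⟨RingQuot.liftAlgHom ℂ ⟨FreeAlgebra.lift ℂ y, ?_⟩, fun i => ?_⟩
  · rintro _ _ ⟨i, j, hij⟩
    simpa using h i j hij
  · simp [Xg]

/-- A linear map satisfying a two-sided Leibniz rule and vanishing on the generators is zero. -/
theorem QSpace.eq_zero_of_leibniz (D : QSpace q n →ₗ[ℂ] QSpace q n)
    (σ τ : QSpace q n → QSpace q n) (h : ∀ a b, D (a * b) = σ a * D b + D a * τ b)
    (h1 : D 1 = 0) (hX : ∀ i, D (Xg q n i) = 0) (a : QSpace q n) : D a = 0 := by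
  let S : Subalgebra ℂ (QSpace q n) :=
    { carrier := {a | D a = 0}
      mul_mem' := fun {a b} ha hb => by
        simp only [Set.mem_ofPred_eq] at ha hb ⊢
        rw [h, ha, hb, mul_zero, zero_mul, add_zero]
      add_mem' := fun {a b} ha hb => by
        simp only [Set.mem_ofPred_eq] at ha hb ⊢
        rw [map_add, ha, hb, add_zero]
      algebraMap_mem' := fun r => by
        simp only [Set.mem_ofPred_eq]
        rw [Algebra.algebraMap_eq_smul_one, map_smul, h1, smul_zero] }
  exact QSpace.mem_of_Xg_mem S hX a

/-- Existence of skew derivations with prescribed values on the generators. -/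
theorem QSpace.exists_skewDerivation (σ τ : QSpace q n →ₐ[ℂ] QSpace q n)
    (d : Fin n → QSpace q n)
    (h : ∀ i j, j < i → σ (Xg q n i) * d j + d i * τ (Xg q n j) =
      q • (σ (Xg q n j) * d i + d j * τ (Xg q n i))) :
    ∃ D : QSpace q n →ₗ[ℂ] QSpace q n, (∀ a b, D (a * b) = σ a * D b + D a * τ b) ∧
      D 1 = 0 ∧ ∀ i, D (Xg q n i) = d i := by
  obtain ⟨φ, hφ⟩ := QSpace.exists_algHom (q := q) (n := n)
    (fun i => !![σ (Xg q n i), d i; 0, τ (Xg q n i)]) (by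
      intro i j hij
      have hσ := congrArg σ (Xg_mul (q := q) i j hij)
      have hτ := congrArg τ (Xg_mul (q := q) i j hij)
      simp only [map_mul, map_smul] at hσ hτ
      ext r s
      fin_cases r <;> fin_cases s <;>
        simp [Matrix.mul_apply, Fin.sum_univ_two, hσ, hτ, h i j hij])
  have key : ∀ a, φ a 0 0 = σ a ∧ φ a 1 0 = 0 ∧ φ a 1 1 = τ a := by
    let S : Subalgebra ℂ (QSpace q n) :=
      { carrier := {a | φ a 0 0 = σ a ∧ φ a 1 0 = 0 ∧ φ a 1 1 = τ a}
        mul_mem' := by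
          rintro a b ⟨h1, h2, h3⟩ ⟨h4, h5, h6⟩
          simp [Matrix.mul_apply, Fin.sum_univ_two, h1, h2, h3, h4, h5, h6]
        add_mem' := by
          rintro a b ⟨h1, h2, h3⟩ ⟨h4, h5, h6⟩
          simp [h1, h2, h3, h4, h5, h6]
        algebraMap_mem' := fun r => by
          simp [Matrix.algebraMap_matrix_apply] }
    exact QSpace.mem_of_Xg_mem S fun i => by
      change φ _ 0 0 = _ ∧ φ _ 1 0 = 0 ∧ φ _ 1 1 = _
      simp [hφ]
  refine ⟨Matrix.entryLinearMap ℂ _ 0 1 ∘ₗ φ.toLinearMap, fun a b => ?_, ?_, fun i => ?_⟩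
  · simp [Matrix.mul_apply, Fin.sum_univ_two, (key a).1, (key b).2.2]
  · simp
  · simp [hφ]

/-- The diagonal automorphism `x_i ↦ t_i x_i`. -/
theorem QSpace.exists_diagonal (t : Fin n → ℂ) (ht : ∀ i, t i ≠ 0) :
    ∃ ψ : QSpace q n ≃ₐ[ℂ] QSpace q n, (∀ i, ψ (Xg q n i) = t i • Xg q n i) ∧
      ∀ i, ψ.symm (Xg q n i) = (t i)⁻¹ • Xg q n i := by
  have H : ∀ s : Fin n → ℂ, ∃ φ : QSpace q n →ₐ[ℂ] QSpace q n,
      ∀ i, φ (Xg q n i) = s i • Xg q n i := fun s =>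
    QSpace.exists_algHom _ fun i j hij => by
      simp only [smul_mul_assoc, mul_smul_comm, Xg_mul i j hij]
      module
  obtain ⟨φ, hφ⟩ := H t
  obtain ⟨χ, hχ⟩ := H fun i => (t i)⁻¹
  refine ⟨AlgEquiv.ofAlgHom φ χ (QSpace.algHom_eq fun i => ?_)
    (QSpace.algHom_eq fun i => ?_), fun i => hφ i, fun i => hχ i⟩
  · simp [hφ, hχ, smul_smul, ht i]
  · simp [hφ, hχ, smul_smul, ht i]

end QuantumSpace

section Builder

variable {q : ℂ} {m n : ℕ}

theorem cartan_comm (i j : Fin m) : cartan m i j = cartan m j i := by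
  unfold cartan
  have h : ((i : ℤ) - (j : ℤ)).natAbs = ((j : ℤ) - (i : ℤ)).natAbs := by omega
  rw [h]
  simp only [eq_comm]

/-- The quantum Serre expression in two operators. -/
def serreOp {A : Type*} [Ring A] [Algebra ℂ A] (q : ℂ) (u v : A →ₗ[ℂ] A) : A →ₗ[ℂ] A :=
  u ∘ₗ u ∘ₗ v - (q + q⁻¹) • (u ∘ₗ v ∘ₗ u) + v ∘ₗ u ∘ₗ u

/-- The quantum Serre expression of skew-primitive operators is skew-primitive. -/
theorem serreOp_leibniz {A : Type*} [Ring A] [Algebra ℂ A] (hq : q ≠ 0)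
    (u v : A →ₗ[ℂ] A) (σ τ : A →ₐ[ℂ] A)
    (hu : ∀ a b, u (a * b) = a * u b + u a * σ b)
    (hv : ∀ a b, v (a * b) = a * v b + v a * τ b)
    (hστ : ∀ a, τ (σ a) = σ (τ a))
    (hσu : ∀ a, σ (u a) = q ^ 2 • u (σ a)) (hσv : ∀ a, σ (v a) = q⁻¹ • v (σ a))
    (hτu : ∀ a, τ (u a) = q⁻¹ • u (τ a)) (a b : A) :
    serreOp q u v (a * b) = a * serreOp q u v b + serreOp q u v a * σ (σ (τ b)) := by
  simp only [serreOp, LinearMap.add_apply, LinearMap.sub_apply, LinearMap.smul_apply,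
    LinearMap.comp_apply, hu, hv, map_add, map_smul, hσu, hσv, hτu, hστ, mul_add, add_mul,
    mul_sub, sub_mul, mul_smul_comm, smul_mul_assoc, smul_add]
  match_scalars <;> field_simp <;> ring

/-- The mirror image of `serreOp_leibniz`. -/
theorem serreOp_leibniz' {A : Type*} [Ring A] [Algebra ℂ A] (hq : q ≠ 0)
    (u v : A →ₗ[ℂ] A) (σ τ : A →ₐ[ℂ] A)
    (hu : ∀ a b, u (a * b) = σ a * u b + u a * b)
    (hv : ∀ a b, v (a * b) = τ a * v b + v a * b)
    (hστ : ∀ a, τ (σ a) = σ (τ a))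
    (hσu : ∀ a, σ (u a) = q ^ 2 • u (σ a)) (hσv : ∀ a, σ (v a) = q⁻¹ • v (σ a))
    (hτu : ∀ a, τ (u a) = q⁻¹ • u (τ a)) (a b : A) :
    serreOp q u v (a * b) = σ (σ (τ a)) * serreOp q u v b + serreOp q u v a * b := by
  simp only [serreOp, LinearMap.add_apply, LinearMap.sub_apply, LinearMap.smul_apply,
    LinearMap.comp_apply, hu, hv, map_add, map_smul, hσu, hσv, hτu, hστ, mul_add, add_mul,
    mul_sub, sub_mul, mul_smul_comm, smul_mul_assoc, smul_add]
  match_scalars <;> field_simp <;> ring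

/-- Operators on a quantum space satisfying the twisted Leibniz rules form a module-algebra
structure as soon as the defining relations hold on the generators. -/
theorem UqslMA.exists_of_generators (hq : q ≠ 0)
    (k : Fin m → (QSpace q n ≃ₐ[ℂ] QSpace q n)) (e f : Fin m → (QSpace q n →ₗ[ℂ] QSpace q n))
    (e_mul : ∀ i a b, e i (a * b) = a * e i b + e i a * k i b)
    (f_mul : ∀ i a b, f i (a * b) = (k i).symm a * f i b + f i a * b)
    (e_one : ∀ i, e i 1 = 0) (f_one : ∀ i, f i 1 = 0)
    (k_comm : ∀ i j l, k i (k j (Xg q n l)) = k j (k i (Xg q n l)))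
    (ke : ∀ i j l, k i (e j (Xg q n l)) = q ^ cartan m i j • e j (k i (Xg q n l)))
    (kf : ∀ i j l, k i (f j (Xg q n l)) = q ^ (-cartan m i j) • f j (k i (Xg q n l)))
    (ef : ∀ i j l, e i (f j (Xg q n l)) - f j (e i (Xg q n l)) =
      if i = j then (q - q⁻¹)⁻¹ • (k i (Xg q n l) - (k i).symm (Xg q n l)) else 0)
    (ee_comm : ∀ i j, cartan m i j = 0 → ∀ l, e i (e j (Xg q n l)) = e j (e i (Xg q n l)))
    (ff_comm : ∀ i j, cartan m i j = 0 → ∀ l, f i (f j (Xg q n l)) = f j (f i (Xg q n l)))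
    (serre_e : ∀ i j, cartan m i j = -1 → ∀ l, serreOp q (e i) (e j) (Xg q n l) = 0)
    (serre_f : ∀ i j, cartan m i j = -1 → ∀ l, serreOp q (f i) (f j) (Xg q n l) = 0) :
    ∃ π : UqslMA q m (QSpace q n), π.k = k ∧ π.e = e ∧ π.f = f := by
  have hkk : ∀ i j a, k i (k j a) = k j (k i a) := fun i j =>
    DFunLike.congr_fun (QSpace.algHom_eq
      (φ := (k i).toAlgHom.comp (k j).toAlgHom) (ψ := (k j).toAlgHom.comp (k i).toAlgHom)
      (k_comm i j))
  have hks : ∀ i j a, k i ((k j).symm a) = (k j).symm (k i a) := fun i j a => by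
    rw [AlgEquiv.eq_symm_apply, ← hkk, AlgEquiv.apply_symm_apply]
  have hss : ∀ i j a, (k i).symm ((k j).symm a) = (k j).symm ((k i).symm a) := fun i j a => by
    rw [AlgEquiv.symm_apply_eq, hks, AlgEquiv.apply_symm_apply]
  have hke : ∀ i j a, k i (e j a) = q ^ cartan m i j • e j (k i a) := fun i j a => by
    refine sub_eq_zero.1 (QSpace.eq_zero_of_leibniz
      ((k i).toLinearMap ∘ₗ e j - q ^ cartan m i j • (e j ∘ₗ (k i).toLinearMap))
      (k i) (fun b => k i (k j b)) (fun a b => ?_) ?_ (fun l => ?_) a)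
    · simp only [LinearMap.sub_apply, LinearMap.smul_apply, LinearMap.comp_apply,
        AlgEquiv.toLinearMap_apply, map_mul, map_add, e_mul, mul_sub, sub_mul, smul_add,
        mul_smul_comm, smul_mul_assoc, hkk j i]
      abel
    · simp [e_one]
    · simp [ke]
  have hkf : ∀ i j a, k i (f j a) = q ^ (-cartan m i j) • f j (k i a) := fun i j a => by
    refine sub_eq_zero.1 (QSpace.eq_zero_of_leibniz
      ((k i).toLinearMap ∘ₗ f j - q ^ (-cartan m i j) • (f j ∘ₗ (k i).toLinearMap))
      (fun a => k i ((k j).symm a)) (k i) (fun a b => ?_) ?_ (fun l => ?_) a)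
    · simp only [LinearMap.sub_apply, LinearMap.smul_apply, LinearMap.comp_apply,
        AlgEquiv.toLinearMap_apply, map_mul, map_add, f_mul, mul_sub, sub_mul, smul_add,
        mul_smul_comm, smul_mul_assoc, hks]
      abel
    · simp [f_one]
    · simp [kf]
  have hse : ∀ i j a, (k i).symm (e j a) = q ^ (-cartan m i j) • e j ((k i).symm a) :=
    fun i j a => by
      rw [AlgEquiv.symm_apply_eq, map_smul, hke, AlgEquiv.apply_symm_apply, smul_smul,
        ← zpow_add₀ hq, neg_add_cancel, zpow_zero, one_smul]
  have hsf : ∀ i j a, (k i).symm (f j a) = q ^ cartan m i j • f j ((k i).symm a) :=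
    fun i j a => by
      rw [AlgEquiv.symm_apply_eq, map_smul, hkf, AlgEquiv.apply_symm_apply, smul_smul,
        ← zpow_add₀ hq, add_neg_cancel, zpow_zero, one_smul]
  have hii : ∀ i : Fin m, cartan m i i = 2 := fun i => if_pos rfl
  refine ⟨⟨k, e, f, e_mul, f_mul, e_one, f_one, hkk, fun i j a => ?_, fun i j a => ?_,
    fun i j a => ?_, fun i j h a => ?_, fun i j h a => ?_, fun i j h a => ?_,
    fun i j h a => ?_⟩, rfl, rfl, rfl⟩
  · rw [hke, AlgEquiv.apply_symm_apply]
  · rw [hkf, AlgEquiv.apply_symm_apply]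
  · by_cases hij : i = j
    · subst hij
      rw [if_pos rfl]
      refine sub_eq_zero.1 (QSpace.eq_zero_of_leibniz
        (e i ∘ₗ f i - f i ∘ₗ e i - (q - q⁻¹)⁻¹ • ((k i).toLinearMap - (k i).symm.toLinearMap))
        (k i).symm (k i) (fun a b => ?_) ?_ (fun l => ?_) a)
      · simp only [LinearMap.sub_apply, LinearMap.smul_apply, LinearMap.comp_apply,
          AlgEquiv.toLinearMap_apply, map_mul, map_add, e_mul, f_mul, hse, hkf, mul_sub, sub_mul,
          smul_sub, mul_smul_comm, smul_mul_assoc]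
        module
      · simp [e_one, f_one]
      · simpa [sub_eq_zero] using ef i i l
    · rw [if_neg hij]
      refine QSpace.eq_zero_of_leibniz (e i ∘ₗ f j - f j ∘ₗ e i)
        (k j).symm (k i) (fun a b => ?_) ?_ (fun l => ?_) a
      · simp only [LinearMap.sub_apply, LinearMap.comp_apply,
          map_add, e_mul, f_mul, hse, hkf, mul_sub, sub_mul, cartan_comm i j,
          mul_smul_comm, smul_mul_assoc]
        module
      · simp [e_one, f_one]
      · simpa [hij] using ef i j l
  · refine sub_eq_zero.1 (QSpace.eq_zero_of_leibniz (e i ∘ₗ e j - e j ∘ₗ e i)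
      id (fun b => k i (k j b)) (fun a b => ?_) ?_ (fun l => ?_) a)
    · have h' : cartan m j i = 0 := cartan_comm i j ▸ h
      simp only [LinearMap.sub_apply, LinearMap.comp_apply, map_add, e_mul, hke, h, h',
        zpow_zero, one_smul, mul_sub, sub_mul, hkk j i, id]
      abel
    · simp [e_one]
    · simp [ee_comm i j h]
  · refine sub_eq_zero.1 (QSpace.eq_zero_of_leibniz (f i ∘ₗ f j - f j ∘ₗ f i)
      (fun a => (k i).symm ((k j).symm a)) id (fun a b => ?_) ?_ (fun l => ?_) a)
    · have h' : cartan m j i = 0 := cartan_comm i j ▸ h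
      simp only [LinearMap.sub_apply, LinearMap.comp_apply, map_add, f_mul, hsf, h, h',
        zpow_zero, one_smul, mul_sub, sub_mul, hss j i, id]
      abel
    · simp [f_one]
    · simp [ff_comm i j h]
  · have h' : cartan m j i = -1 := cartan_comm i j ▸ h
    refine QSpace.eq_zero_of_leibniz (serreOp q (e i) (e j)) id _
      (serreOp_leibniz hq _ _ (k i).toAlgHom (k j).toAlgHom (e_mul i) (e_mul j) (hkk j i)
        (fun a => ?_) (fun a => ?_) (fun a => ?_)) ?_ (serre_e i j h) a
    · simpa [hii] using hke i i a
    · simpa [h] using hke i j a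
    · simpa [h'] using hke j i a
    · simp [serreOp, e_one]
  · have h' : cartan m j i = -1 := cartan_comm i j ▸ h
    refine QSpace.eq_zero_of_leibniz (serreOp q (f i) (f j)) _ id
      (serreOp_leibniz' hq _ _ (k i).symm.toAlgHom (k j).symm.toAlgHom (f_mul i) (f_mul j)
        (hss j i) (fun a => ?_) (fun a => ?_) (fun a => ?_)) ?_ (serre_f i j h) a
    · simpa [hii] using hsf i i a
    · simpa [h] using hsf i j a
    · simpa [h'] using hsf j i a
    · simp [serreOp, f_one]

end Builder

theorem Fin.forall_three_lt {P : Fin 3 → Fin 3 → Prop} (h₁₀ : P 1 0) (h₂₀ : P 2 0)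
    (h₂₁ : P 2 1) (i j : Fin 3) (h : j < i) : P i j := by
  fin_cases i <;> fin_cases j <;> first | assumption | simp at h

set_option maxHeartbeats 1600000 in
theorem UqslMA.exists_A2B4 {q : ℂ} (hq : q ≠ 0) (hq2 : q ^ 2 ≠ 1) {a₀ a₂ : ℂ}
    (h₀ : a₀ ≠ 0) (h₂ : a₂ ≠ 0) :
    ∃ π : UqslMA q 2 (QSpace q 3), KCond13 q π ∧ EFDesc13 q π a₀ a₂ := by
  have hqq : q ^ 2 - 1 ≠ 0 := sub_ne_zero.2 hq2
  have hqi : (q - q⁻¹)⁻¹ = q / (q ^ 2 - 1) := by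
    rw [inv_eq_iff_eq_inv, inv_div]
    field_simp
  have r21 : Xg q 3 1 * Xg q 3 0 = q • (Xg q 3 0 * Xg q 3 1) := Xg_mul 1 0 (by decide)
  have r31 : Xg q 3 2 * Xg q 3 0 = q • (Xg q 3 0 * Xg q 3 2) := Xg_mul 2 0 (by decide)
  have r32 : Xg q 3 2 * Xg q 3 1 = q • (Xg q 3 1 * Xg q 3 2) := Xg_mul 2 1 (by decide)
  have s21 : ∀ b, Xg q 3 1 * (Xg q 3 0 * b) = q • (Xg q 3 0 * (Xg q 3 1 * b)) := fun b => by
    rw [← mul_assoc, r21, smul_mul_assoc, mul_assoc]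
  have s31 : ∀ b, Xg q 3 2 * (Xg q 3 0 * b) = q • (Xg q 3 0 * (Xg q 3 2 * b)) := fun b => by
    rw [← mul_assoc, r31, smul_mul_assoc, mul_assoc]
  have s32 : ∀ b, Xg q 3 2 * (Xg q 3 1 * b) = q • (Xg q 3 1 * (Xg q 3 2 * b)) := fun b => by
    rw [← mul_assoc, r32, smul_mul_assoc, mul_assoc]
  obtain ⟨k₁, hk₁, hk₁'⟩ := QSpace.exists_diagonal (q := q) (n := 3) ![q ^ (-2 : ℤ), q⁻¹, q⁻¹] (by
    intro i; fin_cases i <;> simp [hq])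
  obtain ⟨k₂, hk₂, hk₂'⟩ := QSpace.exists_diagonal (q := q) (n := 3) ![q, q⁻¹, 1] (by
    intro i; fin_cases i <;> simp [hq])
  simp only [Fin.forall_fin_succ, Fin.succ_zero_eq_one,
    Fin.succ_one_eq_two, Matrix.cons_val, IsEmpty.forall_iff, and_true, inv_inv, inv_one,
    one_smul, zpow_neg, zpow_ofNat] at hk₁ hk₁' hk₂ hk₂'
  obtain ⟨hk₁0, hk₁1, hk₁2⟩ := hk₁
  obtain ⟨hk₁0', hk₁1', hk₁2'⟩ := hk₁'
  obtain ⟨hk₂0, hk₂1, hk₂2⟩ := hk₂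
  obtain ⟨hk₂0', hk₂1', hk₂2'⟩ := hk₂'
  obtain ⟨e₁, e₁_mul, e₁_one, he₁⟩ := QSpace.exists_skewDerivation (n := 3)
    (AlgHom.id ℂ (QSpace q 3)) k₁.toAlgHom ![a₀ • 1, 0, 0] (by
      apply Fin.forall_three_lt <;> simp [*, smul_smul])
  obtain ⟨e₂, e₂_mul, e₂_one, he₂⟩ := QSpace.exists_skewDerivation (n := 3)
    (AlgHom.id ℂ (QSpace q 3)) k₂.toAlgHom ![0, a₂ • Xg q 3 0, 0] (by
      apply Fin.forall_three_lt <;> simp [*, smul_smul, mul_comm])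
  obtain ⟨f₁, f₁_mul, f₁_one, hf₁⟩ := QSpace.exists_skewDerivation (n := 3)
    k₁.symm.toAlgHom (AlgHom.id ℂ (QSpace q 3))
    ![(-q * a₀⁻¹) • (Xg q 3 0 ^ 2), (-q * a₀⁻¹) • (Xg q 3 0 * Xg q 3 1),
      (-q * a₀⁻¹) • (Xg q 3 0 * Xg q 3 2)] (by
      apply Fin.forall_three_lt <;> simp [*, pow_two, mul_assoc] <;> module)
  obtain ⟨f₂, f₂_mul, f₂_one, hf₂⟩ := QSpace.exists_skewDerivation (n := 3)
    k₂.symm.toAlgHom (AlgHom.id ℂ (QSpace q 3)) ![a₂⁻¹ • Xg q 3 1, 0, 0] (by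
      apply Fin.forall_three_lt <;> simp [*] <;> module)
  simp only [Fin.forall_fin_succ, Fin.succ_zero_eq_one,
    Fin.succ_one_eq_two, Matrix.cons_val, IsEmpty.forall_iff, and_true, AlgHom.id_apply,
    AlgEquiv.toAlgHom_apply]
    at he₁ he₂ hf₁ hf₂ e₁_mul e₂_mul f₁_mul f₂_mul
  obtain ⟨he₁0, he₁1, he₁2⟩ := he₁
  obtain ⟨he₂0, he₂1, he₂2⟩ := he₂
  obtain ⟨hf₁0, hf₁1, hf₁2⟩ := hf₁
  obtain ⟨hf₂0, hf₂1, hf₂2⟩ := hf₂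
  have se₁ : ∀ l, serreOp q e₁ e₂ (Xg q 3 l) = 0 := by
    simp [Fin.forall_fin_succ, serreOp, *]
  have se₂ : ∀ l, serreOp q e₂ e₁ (Xg q 3 l) = 0 := by
    simp [Fin.forall_fin_succ, serreOp, *]
  have sf₁ : ∀ l, serreOp q f₁ f₂ (Xg q 3 l) = 0 := by
    simp [Fin.forall_fin_succ, serreOp, *, pow_two, mul_assoc, smul_smul, smul_add, mul_add,
      add_smul]
    constructorm* _ ∧ _ <;> match_scalars <;> field_simp <;> ring
  have sf₂ : ∀ l, serreOp q f₂ f₁ (Xg q 3 l) = 0 := by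
    simp [Fin.forall_fin_succ, serreOp, *, pow_two, mul_assoc, smul_smul, smul_add,
      add_smul]
    match_scalars
    field_simp
    ring
  obtain ⟨π, hk, he, hf⟩ := UqslMA.exists_of_generators hq ![k₁, k₂] ![e₁, e₂] ![f₁, f₂]
    (by simpa [Fin.forall_fin_succ] using ⟨e₁_mul, e₂_mul⟩)
    (by simpa [Fin.forall_fin_succ] using ⟨f₁_mul, f₂_mul⟩)
    (by simpa [Fin.forall_fin_succ] using ⟨e₁_one, e₂_one⟩)
    (by simpa [Fin.forall_fin_succ] using ⟨f₁_one, f₂_one⟩)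
    (by simp [Fin.forall_fin_succ, *, smul_smul, mul_comm])
    (by
      simp [Fin.forall_fin_succ, cartan, *, smul_smul]
      constructorm* _ ∧ _ <;> match_scalars <;> field_simp)
    (by
      simp [Fin.forall_fin_succ, cartan, *, pow_two, smul_smul]
      constructorm* _ ∧ _ <;> match_scalars <;> field_simp)
    (by
      simp [Fin.forall_fin_succ, *, pow_two, mul_assoc, smul_smul, smul_add]
      constructorm* _ ∧ _ <;> match_scalars <;> field_simp <;> ring)
    (by simp [Fin.forall_fin_succ, cartan])
    (by simp [Fin.forall_fin_succ, cartan])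
    (by
      simp only [Fin.forall_fin_two]
      simp [cartan, se₁, se₂])
    (by
      simp only [Fin.forall_fin_two]
      simp [cartan, sf₁, sf₂])
  refine ⟨π, ?_, ?_⟩
  · simp [KCond13, Z1, Z2, Z3, *]
  · simp [EFDesc13, Z1, Z2, Z3, *]

section Weights

/-- An eigenvector in the span of eigenvectors lies in the span of those with its eigenvalue. -/
theorem Module.End.mem_span_image_of_eigenvector {K V ι : Type*} [Field K] [AddCommGroup V]
    [Module K V] (T : Module.End K V) (b : ι → V) (w : ι → K) (hb : ∀ i, T (b i) = w i • b i)
    (s : Set ι) {μ : K} {v : V} (hv : v ∈ Submodule.span K (b '' s)) (hT : T v = μ • v) :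
    v ∈ Submodule.span K (b '' {i ∈ s | w i = μ}) := by
  have hle : Submodule.span K (b '' s) ≤
      Submodule.span K (b '' {i ∈ s | w i = μ}) ⊔ ⨆ ν ≠ μ, T.eigenspace ν := by
    rw [Submodule.span_le]
    rintro _ ⟨i, hi, rfl⟩
    by_cases h : w i = μ
    · exact Submodule.mem_sup_left (Submodule.subset_span ⟨i, ⟨hi, h⟩, rfl⟩)
    · exact Submodule.mem_sup_right (Submodule.mem_iSup_of_mem (w i)
        (Submodule.mem_iSup_of_mem h (Module.End.mem_eigenspace_iff.2 (hb i))))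
  have hp' : Submodule.span K (b '' {i ∈ s | w i = μ}) ≤ T.eigenspace μ := by
    rw [Submodule.span_le]
    rintro _ ⟨i, ⟨_, rfl⟩, rfl⟩
    exact Module.End.mem_eigenspace_iff.2 (hb i)
  obtain ⟨p, hp, r, hr, rfl⟩ := Submodule.mem_sup.1 (hle hv)
  have hr' : r ∈ T.eigenspace μ := by
    have := Submodule.sub_mem _ (Module.End.mem_eigenspace_iff.2 hT) (hp' hp)
    rwa [add_sub_cancel_left] at this
  have hr0 : r = 0 := by
    have := T.eigenspaces_iSupIndep μ
    exact Submodule.disjoint_def.1 this r hr' hr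
  rwa [hr0, add_zero]

theorem mul_pow_of_qcomm {A : Type*} [Ring A] [Algebra ℂ A] {q : ℂ} {u v : A}
    (h : u * v = q • (v * u)) (n : ℕ) : u * v ^ n = q ^ n • (v ^ n * u) := by
  induction n with
  | zero => simp
  | succ n ih =>
    rw [pow_succ, ← mul_assoc, ih, smul_mul_assoc, mul_assoc, h, mul_smul_comm, smul_smul,
      ← pow_succ, mul_assoc]

variable {q : ℂ}

/-- The ordered monomials of the quantum 3-space. -/
def QSpace.mono (q : ℂ) (p : ℕ × ℕ × ℕ) : QSpace q 3 :=
  Xg q 3 0 ^ p.1 * Xg q 3 1 ^ p.2.1 * Xg q 3 2 ^ p.2.2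

theorem QSpace.span_mono : Submodule.span ℂ (Set.range (QSpace.mono q)) = ⊤ := by
  set M := Submodule.span ℂ (Set.range (QSpace.mono q)) with hM
  have hmem : ∀ p, QSpace.mono q p ∈ M := fun p => Submodule.subset_span ⟨p, rfl⟩
  have hX : ∀ i, ∀ s ∈ M, Xg q 3 i * s ∈ M := by
    intro i s hs
    induction hs using Submodule.span_induction with
    | zero => simp
    | add x y _ _ hx hy => rw [mul_add]; exact M.add_mem hx hy
    | smul c x _ hx => rw [mul_smul_comm]; exact M.smul_mem c hx
    | mem x hx =>
      obtain ⟨⟨a, b, c⟩, rfl⟩ := hx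
      have h1 : i = 0 ∨ i = 1 ∨ i = 2 := by fin_cases i <;> simp
      rcases h1 with rfl | rfl | rfl
      · convert hmem (a + 1, b, c) using 1
        simp only [QSpace.mono, pow_succ', mul_assoc]
      · convert M.smul_mem (q ^ a) (hmem (a, b + 1, c)) using 1
        simp only [QSpace.mono]
        rw [← mul_assoc, ← mul_assoc, mul_pow_of_qcomm (Xg_mul 1 0 (by decide)), pow_succ']
        simp only [smul_mul_assoc, mul_assoc]
      · convert M.smul_mem (q ^ a * q ^ b) (hmem (a, b, c + 1)) using 1
        simp only [QSpace.mono]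
        rw [← mul_assoc, ← mul_assoc, mul_pow_of_qcomm (Xg_mul 2 0 (by decide)),
          smul_mul_assoc, mul_assoc (Xg q 3 0 ^ a), mul_pow_of_qcomm (Xg_mul 2 1 (by decide)),
          pow_succ']
        simp only [smul_mul_assoc, mul_smul_comm, smul_smul, mul_assoc]
  let S : Subalgebra ℂ (QSpace q 3) :=
    { carrier := {a | ∀ s ∈ M, a * s ∈ M}
      mul_mem' := fun {a b} ha hb s hs => by
        rw [mul_assoc]
        exact ha _ (hb _ hs)
      add_mem' := fun {a b} ha hb s hs => by
        rw [add_mul]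
        exact M.add_mem (ha _ hs) (hb _ hs)
      algebraMap_mem' := fun r s hs => by
        rw [← Algebra.smul_def]
        exact M.smul_mem _ hs }
  refine Submodule.eq_top_iff'.2 fun a => ?_
  have := QSpace.mem_of_Xg_mem S hX a 1 (by simpa [QSpace.mono] using hmem (0, 0, 0))
  rwa [mul_one] at this

theorem zpow_injective_of_not_root {q : ℂ} (hq : q ≠ 0) (hq' : ∀ N : ℕ, 0 < N → q ^ N ≠ 1) :
    Function.Injective fun m : ℤ => q ^ m := by
  have aux : ∀ N : ℤ, q ^ N = 1 → ¬ 0 < N := fun N hN h => by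
    lift N to ℕ using h.le
    exact hq' N (by exact_mod_cast h) (by exact_mod_cast hN)
  intro a b h
  simp only at h
  have h1 : q ^ (a - b) = 1 := by rw [zpow_sub₀ hq, h, div_self (zpow_ne_zero _ hq)]
  have h2 : q ^ (b - a) = 1 := by rw [zpow_sub₀ hq, h, div_self (zpow_ne_zero _ hq)]
  have h3 := aux _ h1
  have h4 := aux _ h2
  omega

/-- Joint weight vectors are combinations of the monomials of the same weight. -/
theorem KCond13.mem_span_mono (hq : q ≠ 0) (hq' : ∀ N : ℕ, 0 < N → q ^ N ≠ 1)
    {π : UqslMA q 2 (QSpace q 3)} (hπ : KCond13 q π) {m n : ℤ} {v : QSpace q 3}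
    (h₀ : π.k 0 v = q ^ m • v) (h₁ : π.k 1 v = q ^ n • v) (s : Set (ℕ × ℕ × ℕ))
    (hs : ∀ a b c : ℕ, 2 * a + b + c = -m → (a - b : ℤ) = n → (a, b, c) ∈ s) :
    v ∈ Submodule.span ℂ (QSpace.mono q '' s) := by
  have hinj := zpow_injective_of_not_root hq hq'
  obtain ⟨k00, k01, k02, k10, k11, k12⟩ := hπ
  simp only [Z1, Z2, Z3] at k00 k01 k02 k10 k11 k12
  have hv : v ∈ Submodule.span ℂ (QSpace.mono q '' Set.univ) := by
    rw [Set.image_univ, QSpace.span_mono]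
    trivial
  have hv₀ := Module.End.mem_span_image_of_eigenvector (π.k 0).toLinearMap (QSpace.mono q)
    (fun p => q ^ (-(2 * p.1 + p.2.1 + p.2.2) : ℤ)) (fun p => by
      simp only [QSpace.mono, AlgEquiv.toLinearMap_apply, map_mul, map_pow, k00, k01, k02,
        smul_pow, smul_mul_assoc, mul_smul_comm, smul_smul]
      congr 1
      simp only [← zpow_natCast, ← zpow_mul, inv_zpow', ← zpow_add₀ hq]
      congr 1
      ring) _ hv h₀
  have hv₁ := Module.End.mem_span_image_of_eigenvector (π.k 1).toLinearMap (QSpace.mono q)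
    (fun p => q ^ (p.1 - p.2.1 : ℤ)) (fun p => by
      simp only [QSpace.mono, AlgEquiv.toLinearMap_apply, map_mul, map_pow, k10, k11, k12,
        smul_pow, smul_mul_assoc, mul_smul_comm, smul_smul]
      congr 1
      simp only [← zpow_natCast, inv_zpow', ← zpow_add₀ hq]
      congr 1
      ring) _ hv₀ h₁
  refine Submodule.span_mono (Set.image_mono ?_) hv₁
  rintro ⟨a, b, c⟩ ⟨⟨-, h1⟩, h2⟩
  have h1 := hinj h1
  have h2 := hinj h2
  simp only at h1 h2
  exact hs a b c (by omega) h2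

/-- Evaluation at the `l`-th coordinate vector. -/
theorem QSpace.exists_eval (q : ℂ) (l : Fin 3) :
    ∃ φ : QSpace q 3 →ₐ[ℂ] ℂ, ∀ i, φ (Xg q 3 i) = if i = l then 1 else 0 :=
  QSpace.exists_algHom _ fun i j hij => by
    have : ¬ (i = l ∧ j = l) := fun h => hij.ne (h.2.trans h.1.symm)
    simp only [smul_eq_mul]
    grind

theorem UqslMA.k_e {m : ℕ} {A : Type} [Ring A] [Algebra ℂ A] (π : UqslMA q m A) (i j : Fin m)
    (a : A) : π.k i (π.e j a) = q ^ cartan m i j • π.e j (π.k i a) := by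
  rw [← π.ke, AlgEquiv.symm_apply_apply]

theorem UqslMA.k_f {m : ℕ} {A : Type} [Ring A] [Algebra ℂ A] (π : UqslMA q m A) (i j : Fin m)
    (a : A) : π.k i (π.f j a) = q ^ (-cartan m i j) • π.f j (π.k i a) := by
  rw [← π.kf, AlgEquiv.symm_apply_apply]

theorem KCond13.k_zero {π : UqslMA q 2 (QSpace q 3)} (hπ : KCond13 q π) (l : Fin 3) :
    π.k 0 (Xg q 3 l) = q ^ (![-2, -1, -1] l : ℤ) • Xg q 3 l := by
  obtain ⟨k00, k01, k02, -, -, -⟩ := hπ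
  simp only [Z1, Z2, Z3] at k00 k01 k02
  fin_cases l
  · exact k00
  · simpa using k01
  · simpa using k02

theorem KCond13.k_one {π : UqslMA q 2 (QSpace q 3)} (hπ : KCond13 q π) (l : Fin 3) :
    π.k 1 (Xg q 3 l) = q ^ (![1, -1, 0] l : ℤ) • Xg q 3 l := by
  obtain ⟨-, -, -, k10, k11, k12⟩ := hπ
  simp only [Z1, Z2, Z3] at k10 k11 k12
  fin_cases l
  · simpa using k10
  · simpa using k11
  · simpa using k12

theorem KCond13.e_mem (hq : q ≠ 0) (hq' : ∀ N : ℕ, 0 < N → q ^ N ≠ 1)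
    {π : UqslMA q 2 (QSpace q 3)} (hπ : KCond13 q π) (j : Fin 2) (l : Fin 3)
    (s : Set (ℕ × ℕ × ℕ))
    (hs : ∀ a b c : ℕ, 2 * a + b + c = -(cartan 2 0 j + ![-2, -1, -1] l) →
      (a - b : ℤ) = cartan 2 1 j + ![1, -1, 0] l → (a, b, c) ∈ s) :
    π.e j (Xg q 3 l) ∈ Submodule.span ℂ (QSpace.mono q '' s) := by
  refine hπ.mem_span_mono hq hq' ?_ ?_ s hs
  · rw [π.k_e, hπ.k_zero, map_smul, smul_smul, ← zpow_add₀ hq]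
  · rw [π.k_e, hπ.k_one, map_smul, smul_smul, ← zpow_add₀ hq]

theorem KCond13.f_mem (hq : q ≠ 0) (hq' : ∀ N : ℕ, 0 < N → q ^ N ≠ 1)
    {π : UqslMA q 2 (QSpace q 3)} (hπ : KCond13 q π) (j : Fin 2) (l : Fin 3)
    (s : Set (ℕ × ℕ × ℕ))
    (hs : ∀ a b c : ℕ, 2 * a + b + c = -(-cartan 2 0 j + ![-2, -1, -1] l) →
      (a - b : ℤ) = -cartan 2 1 j + ![1, -1, 0] l → (a, b, c) ∈ s) :
    π.f j (Xg q 3 l) ∈ Submodule.span ℂ (QSpace.mono q '' s) := by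
  refine hπ.mem_span_mono hq hq' ?_ ?_ s hs
  · rw [π.k_f, hπ.k_zero, map_smul, smul_smul, ← zpow_add₀ hq]
  · rw [π.k_f, hπ.k_one, map_smul, smul_smul, ← zpow_add₀ hq]

end Weights

theorem KCond13.exists_EFDesc13 {q : ℂ} (hq : q ≠ 0) (hq' : ∀ N : ℕ, 0 < N → q ^ N ≠ 1)
    {π : UqslMA q 2 (QSpace q 3)} (hπ : KCond13 q π) :
    ∃ a₀ a₂ : ℂ, a₀ ≠ 0 ∧ a₂ ≠ 0 ∧ EFDesc13 q π a₀ a₂ := by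
  have c00 : cartan 2 0 0 = 2 := rfl
  have c01 : cartan 2 0 1 = -1 := rfl
  have c10 : cartan 2 1 0 = -1 := rfl
  have c11 : cartan 2 1 1 = 2 := rfl
  have e00 := hπ.e_mem hq hq' 0 0 {(0, 0, 0)} (by
    simp only [c00, c10, Matrix.cons_val, Set.mem_singleton_iff, Prod.mk.injEq]; omega)
  have e01 := hπ.e_mem hq hq' 0 1 ∅ (by
    simp only [c00, c10, Matrix.cons_val, Set.mem_empty_iff_false]; omega)
  have e02 := hπ.e_mem hq hq' 0 2 ∅ (by
    simp only [c00, c10, Matrix.cons_val, Set.mem_empty_iff_false]; omega)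
  have e10 := hπ.e_mem hq hq' 1 0 ∅ (by
    simp only [c01, c11, Matrix.cons_val, Set.mem_empty_iff_false]; omega)
  have e11 := hπ.e_mem hq hq' 1 1 {(1, 0, 0)} (by
    simp only [c01, c11, Matrix.cons_val, Set.mem_singleton_iff, Prod.mk.injEq]; omega)
  have e12 := hπ.e_mem hq hq' 1 2 ∅ (by
    simp only [c01, c11, Matrix.cons_val, Set.mem_empty_iff_false]; omega)
  have f00 := hπ.f_mem hq hq' 0 0 {(2, 0, 0)} (by
    simp only [c00, c10, Matrix.cons_val, Set.mem_singleton_iff, Prod.mk.injEq]; omega)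
  have f01 := hπ.f_mem hq hq' 0 1 {(1, 1, 0), (0, 0, 3)} (by
    simp only [c00, c10, Matrix.cons_val, Set.mem_insert_iff, Set.mem_singleton_iff,
      Prod.mk.injEq]; omega)
  have f02 := hπ.f_mem hq hq' 0 2 {(1, 0, 1)} (by
    simp only [c00, c10, Matrix.cons_val, Set.mem_singleton_iff, Prod.mk.injEq]; omega)
  have f10 := hπ.f_mem hq hq' 1 0 {(0, 1, 0)} (by
    simp only [c01, c11, Matrix.cons_val, Set.mem_singleton_iff, Prod.mk.injEq]; omega)
  have f11 := hπ.f_mem hq hq' 1 1 ∅ (by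
    simp only [c01, c11, Matrix.cons_val, Set.mem_empty_iff_false]; omega)
  have f12 := hπ.f_mem hq hq' 1 2 ∅ (by
    simp only [c01, c11, Matrix.cons_val, Set.mem_empty_iff_false]; omega)
  simp only [Set.image_singleton, Set.image_empty, Set.image_pair, Submodule.span_empty,
    Submodule.mem_bot, Submodule.mem_span_singleton, Submodule.mem_span_pair, QSpace.mono,
    pow_zero, pow_one, one_mul, mul_one]
    at e00 e01 e02 e10 e11 e12 f00 f01 f02 f10 f11 f12
  obtain ⟨a₀, e00⟩ := e00
  obtain ⟨a₂, e11⟩ := e11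
  obtain ⟨b, f00⟩ := f00
  obtain ⟨c, c', f01⟩ := f01
  obtain ⟨d, f02⟩ := f02
  obtain ⟨g, f10⟩ := f10
  replace e00 := e00.symm
  replace e11 := e11.symm
  replace f00 := f00.symm
  replace f01 := f01.symm
  replace f02 := f02.symm
  replace f10 := f10.symm
  have hq2 : 1 + q ^ 2 ≠ 0 := fun h => hq' 4 (by norm_num) (by linear_combination (q ^ 2 - 1) * h)
  have hqq : q ^ 2 - 1 ≠ 0 := sub_ne_zero.2 (hq' 2 (by norm_num))
  have hqi : (q - q⁻¹)⁻¹ = q / (q ^ 2 - 1) := by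
    rw [inv_eq_iff_eq_inv, inv_div]
    field_simp
  have k00 : π.k 0 (Xg q 3 0) = q ^ (-2 : ℤ) • Xg q 3 0 := by simpa using hπ.k_zero 0
  have k01 : π.k 0 (Xg q 3 1) = q⁻¹ • Xg q 3 1 := by simpa using hπ.k_zero 1
  have k02 : π.k 0 (Xg q 3 2) = q⁻¹ • Xg q 3 2 := by simpa using hπ.k_zero 2
  have k10 : π.k 1 (Xg q 3 0) = q • Xg q 3 0 := by simpa using hπ.k_one 0
  have l00 : (π.k 0).symm (Xg q 3 0) = q ^ 2 • Xg q 3 0 := by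
    rw [AlgEquiv.symm_apply_eq, map_smul, k00, smul_smul]
    simp [hq]
  have l01 : (π.k 0).symm (Xg q 3 1) = q • Xg q 3 1 := by
    rw [AlgEquiv.symm_apply_eq, map_smul, k01, smul_smul, mul_inv_cancel₀ hq, one_smul]
  have l02 : (π.k 0).symm (Xg q 3 2) = q • Xg q 3 2 := by
    rw [AlgEquiv.symm_apply_eq, map_smul, k02, smul_smul, mul_inv_cancel₀ hq, one_smul]
  have l10 : (π.k 1).symm (Xg q 3 0) = q⁻¹ • Xg q 3 0 := by
    rw [AlgEquiv.symm_apply_eq, map_smul, k10, smul_smul, inv_mul_cancel₀ hq, one_smul]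
  have hb : b * a₀ = -q := by
    obtain ⟨φ, hφ⟩ := QSpace.exists_eval q 0
    have h := congrArg φ (π.ef 0 0 (Xg q 3 0))
    simp [f00, e00, k00, l00, hqi, π.f_one, π.e_mul, pow_two, hφ] at h
    have hqq' : q * q - 1 ≠ 0 := by rwa [← pow_two]
    field_simp at h
    have : (1 + q ^ 2) * (b * a₀ + q) = 0 :=
      mul_left_cancel₀ hqq (by linear_combination h)
    linear_combination (mul_eq_zero.1 this).resolve_left hq2
  have hc : c * a₀ = -q := by
    obtain ⟨φ, hφ⟩ := QSpace.exists_eval q 1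
    have h := congrArg φ (π.ef 0 0 (Xg q 3 1))
    simp [f01, e00, e01, e02, k01, l01, hqi, π.e_mul, pow_succ, hφ] at h
    field_simp at h
    exact mul_right_cancel₀ hqq (by linear_combination h)
  have hd : d * a₀ = -q := by
    obtain ⟨φ, hφ⟩ := QSpace.exists_eval q 2
    have h := congrArg φ (π.ef 0 0 (Xg q 3 2))
    simp [f02, e00, e02, k02, l02, hqi, π.e_mul, hφ] at h
    field_simp at h
    exact mul_right_cancel₀ hqq (by linear_combination h)
  have hg : g * a₂ = 1 := by
    obtain ⟨φ, hφ⟩ := QSpace.exists_eval q 0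
    have h := congrArg φ (π.ef 1 1 (Xg q 3 0))
    simp [f10, e10, e11, k10, l10, hqi, hφ] at h
    field_simp at h
    exact h
  have ha₀ : a₀ ≠ 0 := by
    rintro rfl
    exact hq (by linear_combination hb)
  have ha₂ : a₂ ≠ 0 := right_ne_zero_of_mul (hg.trans_ne one_ne_zero)
  have hg' : g ≠ 0 := left_ne_zero_of_mul (hg.trans_ne one_ne_zero)
  have hd' : d ≠ 0 := left_ne_zero_of_mul (hd.trans_ne (neg_ne_zero.2 hq))
  have hc' : c' = 0 := by
    obtain ⟨φ, hφ⟩ := QSpace.exists_eval q 2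
    have h := congrArg φ (π.serre_f 0 1 c01 (Xg q 3 2))
    simp [f12, f02, f10, f01, f00, π.f_mul, l00, l01, l10, pow_two, hφ] at h
    have hqs : q + q⁻¹ ≠ 0 := fun h => hq2 (by field_simp at h; linear_combination h)
    tauto
  have coeff : ∀ t : ℂ, t * a₀ = -q → t = -q * a₀⁻¹ := fun t ht => by
    rw [← ht, mul_inv_cancel_right₀ ha₀]
  refine ⟨a₀, a₂, ha₀, ha₂, ?_, e01, e02, e10, ?_, e12, ?_, ?_, ?_, ?_, f11, f12⟩
  · exact e00
  · exact e11
  · rw [← coeff b hb]; exact f00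
  · rw [← coeff c hc, Z2, f01, hc', zero_smul, add_zero]; rfl
  · rw [← coeff d hd]; exact f02
  · rw [← eq_inv_of_mul_eq_one_left hg]; exact f10

theorem KCond13.iso {q : ℂ} {π π' : UqslMA q 2 (QSpace q 3)} (hπ : KCond13 q π)
    (hπ' : KCond13 q π') {a₀ a₂ : ℂ} (h₀ : a₀ ≠ 0) (h₂ : a₂ ≠ 0) (h : EFDesc13 q π a₀ a₂)
    (h' : EFDesc13 q π' 1 1) : π.Iso π' := by
  obtain ⟨ψ, hψ, hψ'⟩ := QSpace.exists_diagonal (q := q) (n := 3) ![a₀, a₂ * a₀, 1] (by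
    intro i; fin_cases i <;> simp [h₀, h₂])
  have hk : ∀ i a, ψ (π.k i a) = π'.k i (ψ a) := fun i => by
    refine DFunLike.congr_fun (QSpace.algHom_eq (φ := ψ.toAlgHom.comp (π.k i).toAlgHom)
      (ψ := (π'.k i).toAlgHom.comp ψ.toAlgHom) fun l => ?_)
    have key : ∃ t : ℂ, π.k i (Xg q 3 l) = t • Xg q 3 l ∧ π'.k i (Xg q 3 l) = t • Xg q 3 l := by
      have hi : i = 0 ∨ i = 1 := by fin_cases i <;> simp
      rcases hi with rfl | rfl
      · exact ⟨_, hπ.k_zero l, hπ'.k_zero l⟩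
      · exact ⟨_, hπ.k_one l, hπ'.k_one l⟩
    obtain ⟨t, ht, ht'⟩ := key
    simpa [hψ, ht, ht'] using smul_comm _ _ _
  have hks : ∀ i a, ψ ((π.k i).symm a) = (π'.k i).symm (ψ a) := fun i a => by
    rw [AlgEquiv.eq_symm_apply, ← hk, AlgEquiv.apply_symm_apply]
  simp only [Fin.forall_fin_succ, Fin.succ_zero_eq_one,
    Fin.succ_one_eq_two, Matrix.cons_val, IsEmpty.forall_iff, and_true, one_smul] at hψ
  obtain ⟨hψ0, hψ1, hψ2⟩ := hψ
  obtain ⟨e00, e01, e02, e10, e11, e12, f00, f01, f02, f10, f11, f12⟩ := h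
  obtain ⟨e00', e01', e02', e10', e11', e12', f00', f01', f02', f10', f11', f12'⟩ := h'
  simp only [Z1, Z2, Z3] at e00 e01 e02 e10 e11 e12 f00 f01 f02 f10 f11 f12
  simp only [Z1, Z2, Z3] at e00' e01' e02' e10' e11' e12' f00' f01' f02' f10' f11' f12'
  have he : ∀ i a, ψ (π.e i a) = π'.e i (ψ a) := fun i a => by
    refine sub_eq_zero.1 (QSpace.eq_zero_of_leibniz
      (ψ.toLinearMap ∘ₗ π.e i - π'.e i ∘ₗ ψ.toLinearMap)
      ψ (fun b => ψ (π.k i b)) (fun a b => ?_) ?_ (fun l => ?_) a)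
    · simp only [LinearMap.sub_apply, LinearMap.comp_apply, AlgEquiv.toLinearMap_apply,
        map_mul, map_add, π.e_mul, π'.e_mul, mul_sub, sub_mul, hk]
      abel
    · simp [π.e_one, π'.e_one]
    · fin_cases i <;> fin_cases l <;> simp [*, smul_smul]
  have hf : ∀ i a, ψ (π.f i a) = π'.f i (ψ a) := fun i a => by
    refine sub_eq_zero.1 (QSpace.eq_zero_of_leibniz
      (ψ.toLinearMap ∘ₗ π.f i - π'.f i ∘ₗ ψ.toLinearMap)
      (fun a => ψ ((π.k i).symm a)) ψ (fun a b => ?_) ?_ (fun l => ?_) a)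
    · simp only [LinearMap.sub_apply, LinearMap.comp_apply, AlgEquiv.toLinearMap_apply,
        map_mul, map_add, π.f_mul, π'.f_mul, mul_sub, sub_mul, hks]
      abel
    · simp [π.f_one, π'.f_one]
    · fin_cases i <;> fin_cases l <;> simp [*, smul_smul, pow_two] <;>
        match_scalars <;> field_simp <;> try ring
  refine ⟨ψ, fun i a => ?_, fun i a => ?_, fun i a => ?_, fun i a => ?_⟩
  · rw [hk, AlgEquiv.apply_symm_apply]
  · rw [hks, AlgEquiv.apply_symm_apply]
  · rw [he, AlgEquiv.apply_symm_apply]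
  · rw [hf, AlgEquiv.apply_symm_apply]

/-- Classification of `U_q(sl(3))`-module-algebra structures on `A_q(3)` in case
`(A2)|(B4)`: description, converse existence, and isomorphism with the normalized one. -/
theorem Uqsl3_on_Aq3_A2B4 (q : ℂ) (hq : q ≠ 0)
    (hq' : ∀ N : ℕ, 0 < N → q ^ N ≠ 1) :
    (∀ π : UqslMA q 2 (QSpace q 3), KCond13 q π →
      ∃ a₀ a₂ : ℂ, a₀ ≠ 0 ∧ a₂ ≠ 0 ∧ EFDesc13 q π a₀ a₂) ∧
    (∀ a₀ a₂ : ℂ, a₀ ≠ 0 → a₂ ≠ 0 →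
      ∃ π : UqslMA q 2 (QSpace q 3), KCond13 q π ∧ EFDesc13 q π a₀ a₂) ∧
    (∀ π π' : UqslMA q 2 (QSpace q 3),
      KCond13 q π → KCond13 q π' → EFDesc13 q π' 1 1 → π.Iso π') := by
  refine ⟨fun π hπ => hπ.exists_EFDesc13 hq hq', fun a₀ a₂ h₀ h₂ =>
    UqslMA.exists_A2B4 hq (hq' 2 (by norm_num)) h₀ h₂, fun π π' hπ hπ' h' => ?_⟩
  obtain ⟨a₀, a₂, h₀, h₂, h⟩ := hπ.exists_EFDesc13 hq hq'
  exact hπ.iso hπ' h₀ h₂ h h'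
end
end
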